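/- Let τ > 0 and let F : ℝ × 𝒞 → ℝᵐ be weakly nonlinear with constants K > 0, A ≥ 0, and assume K·τ·e < 1, so that through every (s, z) ∈ ℝ × ℝᵐ there is a unique special solution ȳ(s, z). Then for each initial data (t₀, u) ∈ ℝ × 𝒞 with globally defined solution y(t₀,u) : [t₀−τ, ∞) → ℝᵐ of the DDE: (i) the limit ȳ₀ := lim_{s→∞} ȳ(s, y(t₀,u)(s))(t₀) exists in ℝᵐ; (ii) the special solution ȳ(t₀, ȳ₀) satisfies C_u := sup_{t ≥ t₀} e^{t/τ}·‖y(t₀,u)(t) − ȳ(t₀,ȳ₀)(t)‖∞ < ∞, i.e. y(t₀,u) is attracted to ȳ(t₀,ȳ₀) at exponential rate 1/τ; and (iii) for fixed t₀, the bound C_u depends continuously on u ∈ 𝒞. -/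

import Mathlib

open Set

noncomputable section

/-- The history space `𝒞 = C([-τ,0], ℝᵐ)` with the sup norm; `ℝᵐ` carries the max norm. -/
abbrev Hist (τ : ℝ) (m : ℕ) : Type := C(Set.Icc (-τ) (0:ℝ), Fin m → ℝ)

/-- The constant history function `c_v ∈ 𝒞`. -/
def histConst {m : ℕ} (τ : ℝ) (v : Fin m → ℝ) : Hist τ m := ContinuousMap.const _ v

-- The history segment `y_t ∈ 𝒞`, defined by `y_t(s) = y(t+s)` for `s ∈ [-τ,0]`
-- (junk value if `y` is not continuous).
open Classical in
def seg {m : ℕ} (τ : ℝ) (y : ℝ → Fin m → ℝ) (t : ℝ) : Hist τ m :=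
  if hy : Continuous y then
    ⟨fun s => y (t + s.1), hy.comp (continuous_const.add continuous_subtype_val)⟩
  else 0

/-- Operator norm of a matrix, induced by the maximum norms. -/
def opNormMax {m n : ℕ} (W : Matrix (Fin m) (Fin n) ℝ) : ℝ :=
  ‖LinearMap.toContinuousLinearMap W.mulVecLin‖

/-- `y` is a (continuous) solution on `[0,T]` of the DDE `y'(t) = F(t, y_t)` with constant
initial data `y ≡ v` on `[-τ,0]` (one-sided derivatives at the endpoints of `[0,T]`). -/
def IsSolOn {m : ℕ} (τ T : ℝ) (F : ℝ → Hist τ m → Fin m → ℝ)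
    (v : Fin m → ℝ) (y : ℝ → Fin m → ℝ) : Prop :=
  Continuous y ∧ (∀ s ∈ Set.Icc (-τ) (0:ℝ), y s = v) ∧
    ∀ t ∈ Set.Icc (0:ℝ) T, HasDerivWithinAt y (F t (seg τ y t)) (Set.Icc (0:ℝ) T) t

/-- `F` is weakly nonlinear with constants `K`, `A`: continuous, `‖F(t,0)‖ ≤ A`, and globally
Lipschitz in the second variable with constant `K`. -/
def WeaklyNonlinear {m : ℕ} (τ : ℝ) (F : ℝ → Hist τ m → Fin m → ℝ) (K A : ℝ) : Prop :=
  Continuous (fun p : ℝ × Hist τ m => F p.1 p.2) ∧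
    (∀ t : ℝ, ‖F t 0‖ ≤ A) ∧
    ∀ (t : ℝ) (u v : Hist τ m), ‖F t u - F t v‖ ≤ K * ‖u - v‖

/-- `y` is a continuous solution of the DDE `y'(t) = F(t, y_t)` on `[t₀ - τ, ∞)` with initial
data `y(t₀ + s) = u(s)` for `s ∈ [-τ, 0]`. -/
def IsGlobalSol {m : ℕ} (τ : ℝ) (F : ℝ → Hist τ m → Fin m → ℝ)
    (t₀ : ℝ) (u : Hist τ m) (y : ℝ → Fin m → ℝ) : Prop :=
  Continuous y ∧ (∀ s : Set.Icc (-τ) (0:ℝ), y (t₀ + s.1) = u s) ∧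
    ∀ t ∈ Set.Ici t₀, HasDerivWithinAt y (F t (seg τ y t)) (Set.Ici t₀) t

/-- A special solution of the DDE `y'(t) = F(t, y_t)`: a (continuously differentiable) solution
defined on all of `ℝ` satisfying the growth condition `sup_t e^{-|t|/τ} ‖y(t)‖ < ∞`. -/
def IsSpecialSol {m : ℕ} (τ : ℝ) (F : ℝ → Hist τ m → Fin m → ℝ) (y : ℝ → Fin m → ℝ) : Prop :=
  Continuous y ∧ (∀ t : ℝ, HasDerivAt y (F t (seg τ y t)) t) ∧
    ∃ C : ℝ, ∀ t : ℝ, Real.exp (-|t| / τ) * ‖y t‖ ≤ C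

section RealLine

variable {E : Type*} [NormedAddCommGroup E] [NormedSpace ℝ E]

/-- If `a + q c` bounds the ratio `f / w` whenever `c` does, then so does `a / (1 - q)`. -/
theorem le_div_one_sub_mul_of_improving {I : Set ℝ} {f w : ℝ → ℝ} {a q c₀ : ℝ}
    (hw : ∀ t ∈ I, 0 < w t) (hq : q < 1) (h₀ : ∀ t ∈ I, f t ≤ c₀ * w t)
    (step : ∀ c, (∀ t ∈ I, f t ≤ c * w t) → ∀ t ∈ I, f t ≤ (a + q * c) * w t) :
    ∀ t ∈ I, f t ≤ a / (1 - q) * w t := by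
  intro t ht
  have hbdd : BddAbove ((fun t => f t / w t) '' I) := by
    refine ⟨c₀, ?_⟩
    rintro _ ⟨s, hs, rfl⟩
    exact (div_le_iff₀ (hw s hs)).2 (h₀ s hs)
  set c := sSup ((fun t => f t / w t) '' I) with hc
  have hle : ∀ s ∈ I, f s ≤ c * w s := fun s hs =>
    (div_le_iff₀ (hw s hs)).1 (le_csSup hbdd ⟨s, hs, rfl⟩)
  have hcc : c ≤ a + q * c := by
    refine csSup_le ⟨_, t, ht, rfl⟩ ?_
    rintro _ ⟨s, hs, rfl⟩
    exact (div_le_iff₀ (hw s hs)).2 (step c hle s hs)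
  have hca : c ≤ a / (1 - q) := by
    rw [le_div_iff₀ (by linarith)]
    linarith
  exact (hle t ht).trans (mul_le_mul_of_nonneg_right hca (hw t ht).le)

theorem norm_sub_le_sub_of_norm_deriv_le {f f' : ℝ → E} {B B' : ℝ → ℝ} {a b : ℝ} (hab : a ≤ b)
    (hf : ContinuousOn f (Icc a b)) (hf' : ∀ x ∈ Ico a b, HasDerivWithinAt f (f' x) (Ici x) x)
    (hB : ∀ x, HasDerivAt B (B' x) x) (bound : ∀ x ∈ Ico a b, ‖f' x‖ ≤ B' x) :
    ‖f b - f a‖ ≤ B b - B a :=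
  image_norm_le_of_norm_deriv_right_le_deriv_boundary
    (f := fun x => f x - f a) (B := fun x => B x - B a)
    (hf.sub continuousOn_const) (fun x hx => (hf' x hx).sub_const _) (by simp)
    (fun x => (hB x).sub_const _) bound (right_mem_Icc.2 hab)

/-- Growth bound for a delay differential inequality. -/
theorem norm_le_of_delay_inequality {δ δ' : ℝ → E} {t₀ τ K A a q l : ℝ} (hτ : 0 ≤ τ)
    (hA : 0 ≤ A) (ha : 0 ≤ a) (hl : 0 < l) (hq₀ : 0 ≤ q) (hq : q < 1)
    (hKq : K ≤ q * l) (hδ : Continuous δ)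
    (hδ' : ∀ r, t₀ ≤ r → HasDerivWithinAt δ (δ' r) (Ici r) r)
    (hbound : ∀ r, t₀ ≤ r → ∀ c, (∀ s ∈ Icc (r - τ) r, ‖δ s‖ ≤ c) → ‖δ' r‖ ≤ A + K * c)
    (hinit : ∀ t ∈ Icc (t₀ - τ) t₀, ‖δ t‖ ≤ a) {t : ℝ} (ht : t₀ - τ ≤ t) :
    ‖δ t‖ ≤ (a + A / l) / (1 - q) * Real.exp (l * max (t - t₀) 0) := by
  set T := max t t₀ with hT
  have hexp : ∀ s : ℝ, 1 ≤ Real.exp (l * max (s - t₀) 0) := fun s =>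
    Real.one_le_exp (mul_nonneg hl.le (le_max_right _ _))
  obtain ⟨c₀, hc₀⟩ := (isCompact_Icc (a := t₀ - τ) (b := T)).exists_bound_of_continuousOn
    hδ.continuousOn
  refine le_div_one_sub_mul_of_improving (I := Icc (t₀ - τ) T) (f := fun t => ‖δ t‖)
    (w := fun s => Real.exp (l * max (s - t₀) 0)) (c₀ := c₀) (fun s _ => Real.exp_pos _) hq
    ?_ ?_ t ⟨ht, le_max_left _ _⟩
  · intro s hs
    have h := hc₀ s hs
    exact h.trans (le_mul_of_one_le_right ((norm_nonneg _).trans h) (hexp s))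
  · intro c hc s hs
    have hc0 : 0 ≤ c := by
      have h := (norm_nonneg _).trans (hc s hs)
      exact nonneg_of_mul_nonneg_left h (Real.exp_pos _)
    have hAl : 0 ≤ A / l := div_nonneg hA hl.le
    rcases le_total s t₀ with hst | hst
    · calc ‖δ s‖ ≤ a := hinit s ⟨hs.1, hst⟩
        _ ≤ a + A / l + q * c := by nlinarith [mul_nonneg hq₀ hc0]
        _ ≤ _ := le_mul_of_one_le_right (by positivity) (hexp s)
    · have hB : ∀ x, HasDerivAt (fun x => (A / l + q * c) * Real.exp (l * (x - t₀)))
          ((A / l + q * c) * (Real.exp (l * (x - t₀)) * (l * 1))) x := fun x =>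
        ((((hasDerivAt_id x).sub_const t₀).const_mul l).exp).const_mul _
      have key := norm_sub_le_sub_of_norm_deriv_le hst hδ.continuousOn
        (fun x hx => hδ' x hx.1) hB (fun x hx => by
          have h1 : ‖δ' x‖ ≤ A + K * (c * Real.exp (l * (x - t₀))) := by
            refine hbound x hx.1 _ fun r hr => ?_
            rcases le_total (t₀ - τ) r with h | h
            · refine (hc r ⟨h, hr.2.trans (hx.2.le.trans hs.2)⟩).trans ?_
              refine mul_le_mul_of_nonneg_left (Real.exp_le_exp.2 ?_) hc0
              refine mul_le_mul_of_nonneg_left (max_le ?_ ?_) hl.le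
              · linarith [hr.2]
              · linarith [hx.1]
            · have : r = t₀ - τ := le_antisymm h (by linarith [hr.1, hx.1])
              subst this
              refine (hc (t₀ - τ) ⟨le_rfl, hs.1.trans hs.2⟩).trans ?_
              refine mul_le_mul_of_nonneg_left (Real.exp_le_exp.2 ?_) hc0
              refine mul_le_mul_of_nonneg_left (max_le ?_ ?_) hl.le
              · linarith [hr.2]
              · linarith [hx.1]
          have h2 : 1 ≤ Real.exp (l * (x - t₀)) :=
            Real.one_le_exp (mul_nonneg hl.le (by linarith [hx.1]))
          have h3 : A ≤ A * Real.exp (l * (x - t₀)) := le_mul_of_one_le_right hA h2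
          have h4 : K * (c * Real.exp (l * (x - t₀)))
              ≤ q * l * (c * Real.exp (l * (x - t₀))) :=
            mul_le_mul_of_nonneg_right hKq (by positivity)
          have h5 : (A / l + q * c) * (Real.exp (l * (x - t₀)) * (l * 1))
              = A * Real.exp (l * (x - t₀)) + q * l * (c * Real.exp (l * (x - t₀))) := by
            field_simp
          linarith)
      have h0 : ‖δ t₀‖ ≤ a := hinit t₀ ⟨by linarith, le_rfl⟩
      have h1 : ‖δ s‖ ≤ ‖δ s - δ t₀‖ + ‖δ t₀‖ := by
        simpa using norm_add_le (δ s - δ t₀) (δ t₀)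
      have h2 := hexp s
      rw [max_eq_left (sub_nonneg.2 hst)] at h2 ⊢
      have h3 : a ≤ a * Real.exp (l * (s - t₀)) := le_mul_of_one_le_right ha h2
      have h4 : 0 ≤ (A / l + q * c) * Real.exp (l * (t₀ - t₀)) := by positivity
      nlinarith

/-- A contraction principle for the distance weighted by `w`. -/
theorem exists_fixedPoint_of_weighted_contraction [CompleteSpace E] {w : ℝ → ℝ} {x₀ : ℝ → E}
    {Φ : (ℝ → E) → ℝ → E} {q C : ℝ} (hw : Continuous w) (hwpos : ∀ t, 0 < w t)
    (hx₀ : Continuous x₀) (hq₀ : 0 ≤ q) (hq : q < 1)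
    (hcont : ∀ x, Continuous x → (∃ c, ∀ t, ‖x t - x₀ t‖ ≤ c * w t) → Continuous (Φ x))
    (hC : ∀ t, ‖Φ x₀ t - x₀ t‖ ≤ C * w t)
    (hΦ : ∀ x x', Continuous x → Continuous x' → (∃ c, ∀ t, ‖x t - x₀ t‖ ≤ c * w t) →
      (∃ c, ∀ t, ‖x' t - x₀ t‖ ≤ c * w t) → ∀ c, (∀ t, ‖x t - x' t‖ ≤ c * w t) →
      ∀ t, ‖Φ x t - Φ x' t‖ ≤ q * c * w t) :
    ∃ x, Continuous x ∧ Φ x = x ∧ ∀ t, ‖x t - x₀ t‖ ≤ C / (1 - q) * w t := by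
  let emb : BoundedContinuousFunction ℝ E → ℝ → E := fun b t => x₀ t + w t • b t
  have emb_cont : ∀ b, Continuous (emb b) := fun b => hx₀.add (hw.smul b.continuous)
  have emb_dist : ∀ b b' : BoundedContinuousFunction ℝ E, ∀ t,
      ‖emb b t - emb b' t‖ ≤ dist b b' * w t := by
    intro b b' t
    have : emb b t - emb b' t = w t • (b t - b' t) := by simp [emb, smul_sub]
    rw [this, norm_smul, Real.norm_of_nonneg (hwpos t).le, mul_comm, ← dist_eq_norm]
    exact mul_le_mul_of_nonneg_right (BoundedContinuousFunction.dist_coe_le_dist t) (hwpos t).le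
  have emb_zero : emb 0 = x₀ := by ext1 t; simp [emb]
  have emb_bdd : ∀ b, ∃ c, ∀ t, ‖emb b t - x₀ t‖ ≤ c * w t := fun b =>
    ⟨dist b 0, fun t => by simpa only [emb_zero] using emb_dist b 0 t⟩
  have zero_bdd : ∃ c, ∀ t, ‖x₀ t - x₀ t‖ ≤ c * w t := ⟨0, by simp⟩
  have Φ_bdd : ∀ b, ∃ c, ∀ t, ‖(w t)⁻¹ • (Φ (emb b) t - x₀ t)‖ ≤ c := by
    intro b
    obtain ⟨c, hc⟩ := emb_bdd b
    refine ⟨q * c + C, fun t => ?_⟩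
    rw [norm_smul, norm_inv, Real.norm_of_nonneg (hwpos t).le, inv_mul_le_iff₀ (hwpos t)]
    have h1 := hΦ _ _ (emb_cont b) hx₀ (emb_bdd b) zero_bdd c hc t
    have h2 : ‖Φ (emb b) t - x₀ t‖ ≤ ‖Φ (emb b) t - Φ x₀ t‖ + ‖Φ x₀ t - x₀ t‖ := by
      simpa using norm_add_le (Φ (emb b) t - Φ x₀ t) (Φ x₀ t - x₀ t)
    linarith [hC t]
  choose bd hbd using Φ_bdd
  let Ψ : BoundedContinuousFunction ℝ E → BoundedContinuousFunction ℝ E := fun b =>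
    BoundedContinuousFunction.ofNormedAddCommGroup (fun t => (w t)⁻¹ • (Φ (emb b) t - x₀ t))
      ((hw.inv₀ fun t => (hwpos t).ne').smul
        ((hcont _ (emb_cont b) (emb_bdd b)).sub hx₀)) (bd b) (hbd b)
  have Ψ_apply : ∀ b t, Ψ b t = (w t)⁻¹ • (Φ (emb b) t - x₀ t) := fun _ _ => rfl
  have emb_Ψ : ∀ b, emb (Ψ b) = Φ (emb b) := by
    intro b
    ext1 t
    simp [emb, Ψ_apply, smul_smul, (hwpos t).ne']
  have hcontr : ContractingWith ⟨q, hq₀⟩ Ψ := by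
    refine ⟨by exact_mod_cast hq, LipschitzWith.of_dist_le_mul fun b b' => ?_⟩
    refine (BoundedContinuousFunction.dist_le (by positivity)).2 fun t => ?_
    have : Ψ b t - Ψ b' t = (w t)⁻¹ • (Φ (emb b) t - Φ (emb b') t) := by
      simp [Ψ_apply, ← smul_sub]
    rw [dist_eq_norm, this, norm_smul, norm_inv, Real.norm_of_nonneg (hwpos t).le,
      inv_mul_le_iff₀ (hwpos t), mul_comm (w t)]
    exact hΦ _ _ (emb_cont b) (emb_cont b') (emb_bdd b) (emb_bdd b') _ (emb_dist b b') t
  refine ⟨emb hcontr.fixedPoint, emb_cont _, ?_, ?_⟩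
  · rw [← emb_Ψ, hcontr.fixedPoint_isFixedPt]
  · have h1 : dist hcontr.fixedPoint (0 : BoundedContinuousFunction ℝ E) ≤ C / (1 - q) := by
      rw [dist_comm]
      have hC0 : 0 ≤ C :=
        nonneg_of_mul_nonneg_left ((norm_nonneg _).trans (hC 0)) (hwpos 0)
      refine (hcontr.dist_fixedPoint_le 0).trans ?_
      refine div_le_div_of_nonneg_right ?_ (sub_nonneg.2 hq.le)
      rw [dist_comm]
      refine (BoundedContinuousFunction.dist_le hC0).2 fun t => ?_
      rw [Ψ_apply, emb_zero, BoundedContinuousFunction.coe_zero, Pi.zero_apply, dist_zero_right,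
        norm_smul, norm_inv, Real.norm_of_nonneg (hwpos t).le, inv_mul_le_iff₀ (hwpos t),
        mul_comm]
      exact hC t
    intro t
    have h2 := emb_dist hcontr.fixedPoint 0 t
    rw [emb_zero] at h2
    exact h2.trans (mul_le_mul_of_nonneg_right h1 (hwpos t).le)

end RealLine

section Delay

variable {m : ℕ} {τ : ℝ} {F : ℝ → Hist τ m → Fin m → ℝ} {K A : ℝ}

theorem seg_apply {y : ℝ → Fin m → ℝ} (hy : Continuous y) (t : ℝ) (s : Icc (-τ) (0 : ℝ)) :
    seg τ y t s = y (t + s.1) := by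
  simp [seg, hy]

theorem continuous_seg {y : ℝ → Fin m → ℝ} (hy : Continuous y) :
    Continuous fun t => seg τ y t := by
  refine ContinuousMap.continuous_of_continuous_uncurry _ ?_
  have : (Function.uncurry fun t (s : Icc (-τ) (0 : ℝ)) => seg τ y t s)
      = fun p : ℝ × Icc (-τ) (0 : ℝ) => y (p.1 + p.2.1) := by
    ext1 p
    exact seg_apply hy p.1 p.2
  rw [this]
  fun_prop

theorem WeaklyNonlinear.continuous_seg (hF : WeaklyNonlinear τ F K A) {y : ℝ → Fin m → ℝ}
    (hy : Continuous y) : Continuous fun t => F t (seg τ y t) :=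
  hF.1.comp (continuous_id.prodMk (_root_.continuous_seg hy))

theorem WeaklyNonlinear.norm_sub_le (hF : WeaklyNonlinear τ F K A) (hK : 0 ≤ K) (hτ : 0 ≤ τ)
    {x y : ℝ → Fin m → ℝ} (hx : Continuous x) (hy : Continuous y) {t c : ℝ}
    (h : ∀ s ∈ Icc (t - τ) t, ‖x s - y s‖ ≤ c) :
    ‖F t (seg τ x t) - F t (seg τ y t)‖ ≤ K * c := by
  have hc : 0 ≤ c := (norm_nonneg _).trans (h t ⟨by linarith, le_rfl⟩)
  refine (hF.2.2 t _ _).trans (mul_le_mul_of_nonneg_left ?_ hK)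
  refine (ContinuousMap.norm_le _ hc).2 fun s => ?_
  rw [ContinuousMap.sub_apply, seg_apply hx, seg_apply hy]
  exact h _ ⟨by linarith [s.2.1], by linarith [s.2.2]⟩

theorem WeaklyNonlinear.norm_le (hF : WeaklyNonlinear τ F K A) (hK : 0 ≤ K) (hτ : 0 ≤ τ)
    {x : ℝ → Fin m → ℝ} (hx : Continuous x) {t c : ℝ}
    (h : ∀ s ∈ Icc (t - τ) t, ‖x s‖ ≤ c) : ‖F t (seg τ x t)‖ ≤ A + K * c := by
  have h0 : seg τ (0 : ℝ → Fin m → ℝ) t = 0 := by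
    ext1 s
    rw [seg_apply continuous_zero]
    rfl
  have h1 := hF.norm_sub_le hK hτ hx continuous_zero (t := t) (c := c) (by simpa using h)
  rw [h0] at h1
  have h2 : ‖F t (seg τ x t)‖ ≤ ‖F t 0‖ + ‖F t (seg τ x t) - F t 0‖ := by
    simpa using norm_add_le (F t 0) (F t (seg τ x t) - F t 0)
  linarith [hF.2.1 t]

theorem IsGlobalSol.eq_init {t₀ : ℝ} {u : Hist τ m} {y : ℝ → Fin m → ℝ}
    (hy : IsGlobalSol τ F t₀ u y) {t : ℝ} (ht : t ∈ Icc (t₀ - τ) t₀) :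
    y t = u ⟨t - t₀, by linarith [ht.1], by linarith [ht.2]⟩ := by
  rw [← hy.2.1]
  congr 1
  simp

theorem IsGlobalSol.norm_init_le {t₀ : ℝ} {u : Hist τ m} {y : ℝ → Fin m → ℝ}
    (hy : IsGlobalSol τ F t₀ u y) {t : ℝ} (ht : t ∈ Icc (t₀ - τ) t₀) : ‖y t‖ ≤ ‖u‖ := by
  rw [hy.eq_init ht]
  exact u.norm_coe_le_norm _

/-- Lipschitz dependence of global solutions on their initial data. -/
theorem IsGlobalSol.norm_sub_le (hF : WeaklyNonlinear τ F K A) (hK : 0 ≤ K) (hτ : 0 ≤ τ)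
    {l q : ℝ} (hl : 0 < l) (hq₀ : 0 ≤ q) (hq : q < 1) (hKq : K ≤ q * l)
    {t₀ : ℝ} {u v : Hist τ m} {x y : ℝ → Fin m → ℝ}
    (hx : IsGlobalSol τ F t₀ u x) (hy : IsGlobalSol τ F t₀ v y) {t : ℝ} (ht : t₀ ≤ t) :
    ‖x t - y t‖ ≤ ‖u - v‖ / (1 - q) * Real.exp (l * (t - t₀)) := by
  have h := norm_le_of_delay_inequality (δ := fun t => x t - y t)
    (δ' := fun t => F t (seg τ x t) - F t (seg τ y t)) (t₀ := t₀) (τ := τ) (K := K) (A := 0)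
    (a := ‖u - v‖) (q := q) (l := l) hτ le_rfl (norm_nonneg _) hl hq₀ hq hKq
    (hx.1.sub hy.1)
    (fun r hr => ((hx.2.2 r hr).sub (hy.2.2 r hr)).mono (Ici_subset_Ici.2 hr))
    (fun r _ c hc => by simpa using hF.norm_sub_le hK hτ hx.1 hy.1 hc)
    (fun s hs => by
      rw [hx.eq_init hs, hy.eq_init hs, ← ContinuousMap.sub_apply]
      exact (u - v).norm_coe_le_norm _)
    (t := t) (by linarith)
  rwa [zero_div, add_zero, max_eq_left (sub_nonneg.2 ht)] at h

theorem IsGlobalSol.norm_le (hF : WeaklyNonlinear τ F K A) (hA : 0 ≤ A) (hK : 0 ≤ K)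
    (hτ : 0 ≤ τ) {l q : ℝ} (hl : 0 < l) (hq₀ : 0 ≤ q) (hq : q < 1) (hKq : K ≤ q * l)
    {t₀ : ℝ} {u : Hist τ m} {y : ℝ → Fin m → ℝ} (hy : IsGlobalSol τ F t₀ u y) {t : ℝ}
    (ht : t₀ - τ ≤ t) :
    ‖y t‖ ≤ (‖u‖ + A / l) / (1 - q) * Real.exp (l * max (t - t₀) 0) :=
  norm_le_of_delay_inequality (δ' := fun t => F t (seg τ y t)) (τ := τ) (K := K) hτ hA
    (norm_nonneg _) hl hq₀ hq hKq hy.1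
    (fun r hr => (hy.2.2 r hr).mono (Ici_subset_Ici.2 hr))
    (fun _ _ _ hc => hF.norm_le hK hτ hy.1 hc) (fun _ hs => hy.norm_init_le hs) ht

theorem hasDerivAt_integral_field (hF : WeaklyNonlinear τ F K A) {x : ℝ → Fin m → ℝ}
    (hx : Continuous x) (t₀ t : ℝ) :
    HasDerivAt (fun t => ∫ r in t₀..t, F r (seg τ x r)) (F t (seg τ x t)) t :=
  intervalIntegral.integral_hasDerivAt_right ((hF.continuous_seg hx).intervalIntegrable _ _)
    ((hF.continuous_seg hx).stronglyMeasurableAtFilter _ _) (hF.continuous_seg hx).continuousAt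

theorem hasDerivAt_mul_exp (c l t₀ x : ℝ) :
    HasDerivAt (fun x => c * Real.exp (l * (x - t₀))) (c * l * Real.exp (l * (x - t₀))) x := by
  have h := ((((hasDerivAt_id' x).sub_const t₀).const_mul l).exp).const_mul c
  exact h.congr_deriv (by ring)

theorem exists_isGlobalSol (hF : WeaklyNonlinear τ F K A) (hA : 0 ≤ A) (hK : 0 ≤ K) (hτ : 0 ≤ τ)
    {l q : ℝ} (hl : 0 < l) (hq₀ : 0 ≤ q) (hq : q < 1) (hKq : K ≤ q * l)
    (t₀ : ℝ) (u : Hist τ m) : ∃ y, IsGlobalSol τ F t₀ u y := by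
  have hτ0 : -τ ≤ 0 := by linarith
  set v : ℝ → Fin m → ℝ := fun t => u (projIcc (-τ) 0 hτ0 (t - t₀)) with hv
  have hvc : Continuous v := by
    exact u.continuous.comp (continuous_projIcc.comp (continuous_id.sub continuous_const))
  have hvn : ∀ t, ‖v t‖ ≤ ‖u‖ := fun t => u.norm_coe_le_norm _
  have hexp : ∀ t, t₀ ≤ t → 1 ≤ Real.exp (l * (t - t₀)) := fun t ht =>
    Real.one_le_exp (mul_nonneg hl.le (by linarith))
  have hfi : ∀ x : ℝ → Fin m → ℝ, Continuous x →
      Continuous fun t => ∫ r in t₀..t, F r (seg τ x r) := fun x hx =>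
    continuous_iff_continuousAt.2 fun t => (hasDerivAt_integral_field hF hx t₀ t).continuousAt
  have hΦc : ∀ x : ℝ → Fin m → ℝ, Continuous x →
      Continuous fun t => v t + ∫ r in t₀..(max t t₀), F r (seg τ x r) := fun x hx =>
    hvc.add ((hfi x hx).comp (continuous_id.max continuous_const))
  have hmax : ∀ t, max t t₀ - t₀ = max (t - t₀) 0 := fun t => by
    rw [← max_sub_sub_right, sub_self]
  obtain ⟨y, hyc, hy, -⟩ := exists_fixedPoint_of_weighted_contraction
    (w := fun t => Real.exp (l * max (t - t₀) 0)) (x₀ := v)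
    (Φ := fun x t => v t + ∫ r in t₀..(max t t₀), F r (seg τ x r))
    (q := q) (C := (A + K * ‖u‖) / l) (by fun_prop) (fun _ => Real.exp_pos _) hvc hq₀ hq
    (fun x hx _ => hΦc x hx)
    (fun t => by
      simp only [add_sub_cancel_left]
      have hM : 0 ≤ A + K * ‖u‖ := by positivity
      have h := norm_sub_le_sub_of_norm_deriv_le (le_max_right t t₀) (hfi v hvc).continuousOn
        (fun x _ => (hasDerivAt_integral_field hF hvc t₀ x).hasDerivWithinAt)
        (hasDerivAt_mul_exp ((A + K * ‖u‖) / l) l t₀) (fun x hx => by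
          rw [div_mul_cancel₀ _ hl.ne']
          exact (hF.norm_le hK hτ hvc (fun s _ => hvn s)).trans
            (le_mul_of_one_le_right hM (hexp x hx.1)))
      rw [intervalIntegral.integral_same, sub_zero, hmax] at h
      refine h.trans (sub_le_self _ ?_)
      positivity)
    (fun x x' hx hx' _ _ c hc t => by
      simp only [add_sub_add_left_eq_sub]
      have hc0 : 0 ≤ c :=
        nonneg_of_mul_nonneg_left ((norm_nonneg _).trans (hc 0)) (Real.exp_pos _)
      have h := norm_sub_le_sub_of_norm_deriv_le (le_max_right t t₀)
        ((hfi x hx).sub (hfi x' hx')).continuousOn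
        (fun r _ => ((hasDerivAt_integral_field hF hx t₀ r).sub
          (hasDerivAt_integral_field hF hx' t₀ r)).hasDerivWithinAt)
        (hasDerivAt_mul_exp (q * c) l t₀) (fun r hr => by
          have h1 := hF.norm_sub_le hK hτ hx hx' (t := r) (c := c * Real.exp (l * (r - t₀)))
            (fun s hs => (hc s).trans (mul_le_mul_of_nonneg_left (Real.exp_le_exp.2
              (mul_le_mul_of_nonneg_left (max_le (by linarith [hs.2]) (by linarith [hr.1]))
                hl.le)) hc0))
          have h2 := mul_le_mul_of_nonneg_right hKq
            (mul_nonneg hc0 (Real.exp_pos (l * (r - t₀))).le)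
          linarith)
      simp only [Pi.sub_apply, intervalIntegral.integral_same, sub_zero, hmax] at h
      refine h.trans (sub_le_self _ ?_)
      positivity)
  have hyt : ∀ t, y t = v t + ∫ r in t₀..(max t t₀), F r (seg τ y r) := fun t =>
    (congrFun hy t).symm
  refine ⟨y, hyc, fun s => ?_, fun t ht => ?_⟩
  · rw [hyt, max_eq_right (by linarith [s.2.2]), intervalIntegral.integral_same, add_zero]
    simp [hv]
  · have h := ((hasDerivAt_integral_field hF hyc t₀ t).const_add (v t₀)).hasDerivWithinAt
      (s := Ici t₀)
    have heq : ∀ s ∈ Ici t₀, y s = v t₀ + ∫ r in t₀..s, F r (seg τ y r) := by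
      intro s hs
      rw [hyt, max_eq_left hs]
      congr 1
      simp only [hv]
      rw [projIcc_of_right_le _ (by linarith [mem_Ici.1 hs]), projIcc_of_right_le _ (by simp)]
    exact h.congr heq (heq t ht)

/-- A solution on `ℝ`. -/
def IsEntireSol (τ : ℝ) (F : ℝ → Hist τ m → Fin m → ℝ) (y : ℝ → Fin m → ℝ) : Prop :=
  Continuous y ∧ ∀ t, HasDerivAt y (F t (seg τ y t)) t

/-- Entire solutions growing at most like `exp (l |t|)` separate at most like
`exp (l |t - s|)`. -/
theorem IsEntireSol.norm_sub_le (hF : WeaklyNonlinear τ F K A) (hK : 0 ≤ K) (hτ : 0 ≤ τ)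
    {l q : ℝ} (hl : 0 < l) (hq₀ : 0 ≤ q) (hq : q < 1) (hKq : K * Real.exp (l * τ) ≤ q * l)
    {x y : ℝ → Fin m → ℝ} (hx : IsEntireSol τ F x) (hy : IsEntireSol τ F y) {c₀ : ℝ} (s : ℝ)
    (h₀ : ∀ t, ‖x t - y t‖ ≤ c₀ * Real.exp (l * |t - s|)) (t : ℝ) :
    ‖x t - y t‖ ≤ ‖x s - y s‖ / (1 - q) * Real.exp (l * |t - s|) := by
  refine le_div_one_sub_mul_of_improving (I := univ) (f := fun t => ‖x t - y t‖)
    (w := fun t => Real.exp (l * |t - s|)) (c₀ := c₀) (fun _ _ => Real.exp_pos _) hq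
    (fun t _ => h₀ t) ?_ t (mem_univ t)
  intro c hc t _
  have hc0 : 0 ≤ c :=
    nonneg_of_mul_nonneg_left ((norm_nonneg _).trans (hc 0 (mem_univ _))) (Real.exp_pos _)
  have hderiv : ∀ r, ‖F r (seg τ x r) - F r (seg τ y r)‖
      ≤ q * c * l * Real.exp (l * |r - s|) := by
    intro r
    have h1 := hF.norm_sub_le hK hτ hx.1 hy.1 (t := r)
      (c := c * (Real.exp (l * τ) * Real.exp (l * |r - s|))) (fun p hp => by
        refine (hc p (mem_univ _)).trans (mul_le_mul_of_nonneg_left ?_ hc0)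
        rw [← Real.exp_add, ← mul_add]
        refine Real.exp_le_exp.2 (mul_le_mul_of_nonneg_left ?_ hl.le)
        have h3 : |p - r| ≤ τ := abs_le.2 ⟨by linarith [hp.1], by linarith [hp.2]⟩
        have h4 := abs_sub_le p r s
        linarith)
    have h2 := mul_le_mul_of_nonneg_right hKq
      (mul_nonneg hc0 (Real.exp_pos (l * |r - s|)).le)
    linarith
  have hcont := hx.1.sub hy.1
  have hd : ∀ r, HasDerivWithinAt (x - y) (F r (seg τ x r) - F r (seg τ y r)) (Ici r) r :=
    fun r => ((hx.2 r).sub (hy.2 r)).hasDerivWithinAt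
  have hone : 1 ≤ Real.exp (l * |t - s|) := Real.one_le_exp (by positivity)
  have hinc : ‖(x t - y t) - (x s - y s)‖ ≤ q * c * Real.exp (l * |t - s|) := by
    have hpos : 0 ≤ q * c := by positivity
    rcases le_total s t with h | h
    · have key := norm_sub_le_sub_of_norm_deriv_le h hcont.continuousOn (fun r _ => hd r)
        (hasDerivAt_mul_exp (q * c) l s) (fun r hr => by
          have := hderiv r
          rwa [abs_of_nonneg (sub_nonneg.2 hr.1)] at this)
      rw [abs_of_nonneg (sub_nonneg.2 h)]
      refine key.trans (sub_le_self _ ?_)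
      positivity
    · have key := norm_sub_le_sub_of_norm_deriv_le h hcont.continuousOn (fun r _ => hd r)
        (hasDerivAt_mul_exp (-(q * c)) (-l) s) (fun r hr => by
          have := hderiv r
          rw [abs_of_nonpos (sub_nonpos.2 hr.2.le)] at this
          convert this using 1
          ring_nf)
      rw [norm_sub_rev, abs_of_nonpos (sub_nonpos.2 h)]
      refine key.trans ?_
      rw [sub_self, mul_zero, Real.exp_zero, show -l * (t - s) = l * -(t - s) by ring]
      linarith
  have h1 : ‖x t - y t‖ ≤ ‖(x t - y t) - (x s - y s)‖ + ‖x s - y s‖ := by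
    simpa using norm_add_le ((x t - y t) - (x s - y s)) (x s - y s)
  have h2 := le_mul_of_one_le_right (norm_nonneg (x s - y s)) hone
  linarith

/-- Entire solutions whose difference is bounded by `exp (-l t)` on all of `ℝ` coincide. -/
theorem IsEntireSol.eq_of_decay (hF : WeaklyNonlinear τ F K A) (hK : 0 ≤ K) (hτ : 0 ≤ τ)
    {l q : ℝ} (hl : 0 < l) (hq : q < 1) (hKq : K * Real.exp (l * τ) ≤ q * l)
    {x y : ℝ → Fin m → ℝ} (hx : IsEntireSol τ F x) (hy : IsEntireSol τ F y) {c₀ t₀ : ℝ}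
    (h₀ : ∀ t, ‖x t - y t‖ ≤ c₀ * Real.exp (-l * (t - t₀))) : x = y := by
  ext1 t
  have h := le_div_one_sub_mul_of_improving (I := univ) (f := fun t => ‖x t - y t‖)
    (w := fun t => Real.exp (-l * (t - t₀))) (c₀ := c₀) (a := 0) (fun _ _ => Real.exp_pos _) hq
    (fun t _ => h₀ t) ?_ t (mem_univ t)
  · rw [zero_div, zero_mul] at h
    exact sub_eq_zero.1 (norm_le_zero_iff.1 h)
  intro c hc t _
  have hc0 : 0 ≤ c :=
    nonneg_of_mul_nonneg_left ((norm_nonneg _).trans (hc 0 (mem_univ _))) (Real.exp_pos _)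
  have hderiv : ∀ r, ‖F r (seg τ x r) - F r (seg τ y r)‖
      ≤ -(q * c) * -l * Real.exp (-l * (r - t₀)) := by
    intro r
    have h1 := hF.norm_sub_le hK hτ hx.1 hy.1 (t := r)
      (c := c * (Real.exp (l * τ) * Real.exp (-l * (r - t₀)))) (fun p hp => by
        refine (hc p (mem_univ _)).trans (mul_le_mul_of_nonneg_left ?_ hc0)
        rw [← Real.exp_add]
        exact Real.exp_le_exp.2 (by nlinarith [hp.1]))
    have h2 := mul_le_mul_of_nonneg_right hKq
      (mul_nonneg hc0 (Real.exp_pos (-l * (r - t₀))).le)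
    linarith
  have hlim : Filter.Tendsto (fun T => c * Real.exp (-l * (T - t₀))
      + (0 + q * c) * Real.exp (-l * (t - t₀))) Filter.atTop
      (nhds (c * 0 + (0 + q * c) * Real.exp (-l * (t - t₀)))) := by
    refine Filter.Tendsto.add_const _ (Filter.Tendsto.const_mul _ ?_)
    refine Real.tendsto_exp_atBot.comp ?_
    exact (Filter.tendsto_atTop_add_const_right _ (-t₀) Filter.tendsto_id).const_mul_atTop_of_neg
      (neg_neg_of_pos hl)
  rw [mul_zero, zero_add ((0 + q * c) * _)] at hlim
  refine ge_of_tendsto hlim ?_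
  filter_upwards [Filter.eventually_ge_atTop t] with T hT
  have key := norm_sub_le_sub_of_norm_deriv_le hT (hx.1.sub hy.1).continuousOn
    (fun r _ => ((hx.2 r).sub (hy.2 r)).hasDerivWithinAt)
    (hasDerivAt_mul_exp (-(q * c)) (-l) t₀) (fun r _ => hderiv r)
  have h1 : ‖x t - y t‖ ≤ ‖x T - y T‖ + ‖(x T - y T) - (x t - y t)‖ := by
    have := _root_.norm_sub_le (x T - y T) ((x T - y T) - (x t - y t))
    simpa using this
  have h2 := hc T (mem_univ _)
  simp only [Pi.sub_apply] at key
  have hcT : 0 ≤ q * c * Real.exp (-l * (T - t₀)) := by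
    have hq₀ : 0 ≤ q := by
      have : 0 ≤ q * l := (mul_nonneg hK (Real.exp_pos _).le).trans hKq
      exact nonneg_of_mul_nonneg_left this hl
    positivity
  linarith

theorem integrableOn_field_sub_and_norm_integral_le (hF : WeaklyNonlinear τ F K A) (hK : 0 ≤ K)
    (hτ : 0 ≤ τ) {l q : ℝ} (hl : 0 < l) (hKq : K * Real.exp (l * τ) ≤ q * l)
    {x y : ℝ → Fin m → ℝ} (hx : Continuous x) (hy : Continuous y) {c t₀ : ℝ}
    (h : ∀ t, ‖x t - y t‖ ≤ c * Real.exp (-l * (t - t₀))) (t : ℝ) :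
    MeasureTheory.IntegrableOn (fun r => F r (seg τ x r) - F r (seg τ y r)) (Ioi t) ∧
      ‖∫ r in Ioi t, (F r (seg τ x r) - F r (seg τ y r))‖
        ≤ q * c * Real.exp (-l * (t - t₀)) := by
  have hc0 : 0 ≤ c :=
    nonneg_of_mul_nonneg_left ((norm_nonneg _).trans (h 0)) (Real.exp_pos _)
  have hsplit : ∀ r, Real.exp (-l * (r - t₀)) = Real.exp (l * t₀) * Real.exp (-l * r) := by
    intro r
    rw [← Real.exp_add]
    ring_nf
  have hbound : ∀ r, ‖F r (seg τ x r) - F r (seg τ y r)‖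
      ≤ q * c * l * Real.exp (l * t₀) * Real.exp (-l * r) := by
    intro r
    have h1 := hF.norm_sub_le hK hτ hx hy (t := r)
      (c := c * (Real.exp (l * τ) * Real.exp (-l * (r - t₀)))) (fun p hp => by
        refine (h p).trans (mul_le_mul_of_nonneg_left ?_ hc0)
        rw [← Real.exp_add]
        exact Real.exp_le_exp.2 (by nlinarith [hp.1]))
    have h2 := mul_le_mul_of_nonneg_right hKq
      (mul_nonneg hc0 (Real.exp_pos (-l * (r - t₀))).le)
    have h3 := hsplit r
    rw [mul_assoc _ (Real.exp (l * t₀)), ← h3]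
    linarith
  have hfi := (integrableOn_exp_mul_Ioi (neg_neg_of_pos hl) t).const_mul
    (q * c * l * Real.exp (l * t₀))
  have hcont := (hF.continuous_seg hx).sub (hF.continuous_seg hy)
  refine ⟨hfi.mono' hcont.aestronglyMeasurable (Filter.Eventually.of_forall hbound), ?_⟩
  refine (MeasureTheory.norm_integral_le_of_norm_le hfi
    (Filter.Eventually.of_forall hbound)).trans (le_of_eq ?_)
  rw [MeasureTheory.integral_const_mul, integral_exp_mul_Ioi (neg_neg_of_pos hl), hsplit]
  field_simp

/-- Every global solution is attracted to an entire solution. -/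
theorem IsGlobalSol.exists_attracting_entireSol (hF : WeaklyNonlinear τ F K A) (hA : 0 ≤ A)
    (hK : 0 ≤ K) (hτ : 0 ≤ τ) {l μ q : ℝ} (hl : 0 < l) (hlμ : l ≤ μ) (hq₀ : 0 ≤ q) (hq : q < 1)
    (hlq : K * Real.exp (l * τ) ≤ q * l) (hμq : K * Real.exp (μ * τ) ≤ q * μ)
    {t₀ : ℝ} {u : Hist τ m} {y : ℝ → Fin m → ℝ} (hy : IsGlobalSol τ F t₀ u y) :
    ∃ x, IsEntireSol τ F x ∧
      (∀ t, t₀ ≤ t → ‖y t - x t‖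
        ≤ (2 * ‖u‖ + (A + K * ‖u‖) / l) / (1 - q) * Real.exp (-μ * (t - t₀))) ∧
      ∀ t, t ≤ t₀ → ‖x t‖
        ≤ ‖u‖ + (2 * ‖u‖ + (A + K * ‖u‖) / l) / (1 - q) * Real.exp (-l * (t - t₀)) := by
  have hμ : 0 < μ := hl.trans_le hlμ
  set z : ℝ → Fin m → ℝ := fun t => y (max t (t₀ - τ)) with hz
  have hzc : Continuous z := hy.1.comp (continuous_id.max continuous_const)
  have hzy : ∀ t, t₀ - τ ≤ t → z t = y t := fun t ht => by simp only [hz, max_eq_left ht]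
  have hzu : ∀ t, t ≤ t₀ → ‖z t‖ ≤ ‖u‖ := fun t ht =>
    hy.norm_init_le ⟨le_max_right _ _, max_le ht (by linarith)⟩
  set p : ℝ → Fin m → ℝ := fun t => y t₀ + ∫ r in t₀..t, F r (seg τ z r) with hp
  have hpd : ∀ t, HasDerivAt p (F t (seg τ z t)) t := fun t =>
    (hasDerivAt_integral_field hF hzc t₀ t).const_add _
  have hpc : Continuous p := continuous_iff_continuousAt.2 fun t => (hpd t).continuousAt
  have hp₀ : p t₀ = y t₀ := by simp [hp]
  have hpy : ∀ t, t₀ ≤ t → p t = y t := by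
    intro t ht
    have h := norm_sub_le_sub_of_norm_deriv_le (B := fun _ => 0) (B' := fun _ => 0) ht
      (hpc.sub hy.1).continuousOn
      (fun r hr => (hpd r).hasDerivWithinAt.sub
        ((hy.2.2 r hr.1).mono (Ici_subset_Ici.2 hr.1)))
      (fun r => hasDerivAt_const r 0) (fun r hr => by
        have := hF.norm_sub_le hK hτ hzc hy.1 (t := r) (c := 0) (fun s hs => by
          rw [hzy s (by linarith [hs.1, hr.1])]
          simp)
        rwa [mul_zero] at this)
    simp only [Pi.sub_apply, hp₀, sub_self, sub_zero] at h
    exact sub_eq_zero.1 (norm_le_zero_iff.1 h)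
  set w : ℝ → ℝ := fun t => min (Real.exp (-l * (t - t₀))) (Real.exp (-μ * (t - t₀))) with hw
  have hwpos : ∀ t, 0 < w t := fun t => lt_min (Real.exp_pos _) (Real.exp_pos _)
  have hwleft : ∀ t, t ≤ t₀ → w t = Real.exp (-l * (t - t₀)) := fun t ht =>
    min_eq_left (Real.exp_le_exp.2 (by nlinarith))
  have hnonneg : ∀ {x x' : ℝ → Fin m → ℝ} {c : ℝ}, (∀ t, ‖x t - x' t‖ ≤ c * w t) → 0 ≤ c :=
    fun h => nonneg_of_mul_nonneg_left ((norm_nonneg _).trans (h 0)) (hwpos 0)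
  have hwl : ∀ {x x' : ℝ → Fin m → ℝ} {c : ℝ}, (∀ t, ‖x t - x' t‖ ≤ c * w t) →
      ∀ t, ‖x t - x' t‖ ≤ c * Real.exp (-l * (t - t₀)) := fun h t =>
    (h t).trans (mul_le_mul_of_nonneg_left (min_le_left _ _) (hnonneg h))
  have hwμ : ∀ {x x' : ℝ → Fin m → ℝ} {c : ℝ}, (∀ t, ‖x t - x' t‖ ≤ c * w t) →
      ∀ t, ‖x t - x' t‖ ≤ c * Real.exp (-μ * (t - t₀)) := fun h t =>
    (h t).trans (mul_le_mul_of_nonneg_left (min_le_right _ _) (hnonneg h))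
  have hfi : ∀ x, Continuous x → (∃ c, ∀ t, ‖x t - z t‖ ≤ c * w t) → ∀ t,
      MeasureTheory.IntegrableOn (fun r => F r (seg τ x r) - F r (seg τ z r)) (Ioi t) := by
    rintro x hx ⟨c, hc⟩ t
    exact (integrableOn_field_sub_and_norm_integral_le hF hK hτ hl hlq hx hzc (hwl hc) t).1
  have hΦd : ∀ x, Continuous x → (∃ c, ∀ t, ‖x t - z t‖ ≤ c * w t) → ∀ t,
      HasDerivAt (fun t => p t - ∫ r in Ioi t, (F r (seg τ x r) - F r (seg τ z r)))
        (F t (seg τ x t)) t := by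
    intro x hx hxz t
    have hcont := (hF.continuous_seg hx).sub (hF.continuous_seg hzc)
    have heq : (fun t => p t - ∫ r in Ioi t, (F r (seg τ x r) - F r (seg τ z r)))
        = fun t => p t - ((∫ r in Ioi t₀, (F r (seg τ x r) - F r (seg τ z r)))
          - ∫ r in t₀..t, (F r (seg τ x r) - F r (seg τ z r))) := by
      ext1 t
      rw [← intervalIntegral.integral_interval_add_Ioi (hfi x hx hxz t₀) (hfi x hx hxz t),
        add_sub_cancel_left]
    rw [heq]
    have h := (hpd t).sub ((intervalIntegral.integral_hasDerivAt_right
      (hcont.intervalIntegrable t₀ t) (hcont.stronglyMeasurableAtFilter _ _)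
      hcont.continuousAt).const_sub
        (∫ r in Ioi t₀, (F r (seg τ x r) - F r (seg τ z r))))
    exact h.congr_deriv (by simp only [Pi.sub_apply]; abel)
  have hzz : ∀ t, ‖z t - z t‖ ≤ 0 * w t := by simp
  obtain ⟨x, hxc, hx, hxz⟩ := exists_fixedPoint_of_weighted_contraction (w := w) (x₀ := z)
    (Φ := fun x t => p t - ∫ r in Ioi t, (F r (seg τ x r) - F r (seg τ z r)))
    (q := q) (C := 2 * ‖u‖ + (A + K * ‖u‖) / l) (by fun_prop) hwpos hzc hq₀ hq
    (fun x hx hxz => continuous_iff_continuousAt.2 fun t => (hΦd x hx hxz t).continuousAt)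
    (fun t => by
      have hM : 0 ≤ A + K * ‖u‖ := by positivity
      simp only [sub_self, MeasureTheory.integral_zero, sub_zero]
      rcases le_total t₀ t with ht | ht
      · rw [hpy t ht, hzy t (by linarith), sub_self, norm_zero]
        exact mul_nonneg (by positivity) (hwpos t).le
      · have hone : ∀ r, r ≤ t₀ → 1 ≤ Real.exp (-l * (r - t₀)) := fun r hr =>
          Real.one_le_exp (by nlinarith)
        have h := norm_sub_le_sub_of_norm_deriv_le ht hpc.continuousOn
          (fun r _ => (hpd r).hasDerivWithinAt)
          (hasDerivAt_mul_exp (-((A + K * ‖u‖) / l)) (-l) t₀) (fun r hr => by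
            rw [neg_mul_neg, div_mul_cancel₀ _ hl.ne']
            exact (hF.norm_le hK hτ hzc (fun s hs => hzu s (by linarith [hs.2, hr.2]))).trans
              (le_mul_of_one_le_right hM (hone r hr.2.le)))
        rw [hwleft t ht]
        have h1 : ‖p t - z t‖ ≤ ‖p t₀ - p t‖ + ‖p t₀‖ + ‖z t‖ := by
          have e : p t - z t = p t₀ - (p t₀ - p t) - z t := by abel
          rw [e]
          have e1 := _root_.norm_sub_le (p t₀ - (p t₀ - p t)) (z t)
          have e2 := _root_.norm_sub_le (p t₀) (p t₀ - p t)
          linarith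
        have h2 : ‖p t₀‖ ≤ ‖u‖ := by
          rw [hp₀]
          exact hy.norm_init_le ⟨by linarith, le_rfl⟩
        have h3 := hzu t ht
        have h4 := le_mul_of_one_le_right (norm_nonneg u) (hone t ht)
        have h5 : 0 ≤ (A + K * ‖u‖) / l := by positivity
        rw [sub_self, mul_zero, Real.exp_zero] at h
        linarith)
    (fun x x' hx hx' hxz hxz' c hc t => by
      have e : (p t - ∫ r in Ioi t, (F r (seg τ x r) - F r (seg τ z r)))
          - (p t - ∫ r in Ioi t, (F r (seg τ x' r) - F r (seg τ z r)))
          = -∫ r in Ioi t, (F r (seg τ x r) - F r (seg τ x' r)) := by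
        rw [sub_sub_sub_cancel_left, ← MeasureTheory.integral_sub (hfi x' hx' hxz' t)
          (hfi x hx hxz t), ← MeasureTheory.integral_neg]
        simp only [sub_sub_sub_cancel_right, neg_sub]
      simp only [e, norm_neg]
      have h1 := (integrableOn_field_sub_and_norm_integral_le hF hK hτ hl hlq hx hx'
        (hwl hc) t).2
      have h2 := (integrableOn_field_sub_and_norm_integral_le hF hK hτ hμ hμq hx hx'
        (hwμ hc) t).2
      rw [hw, mul_min_of_nonneg _ _ (mul_nonneg hq₀ (hnonneg hc))]
      exact le_min h1 h2)
  refine ⟨x, ⟨hxc, fun t => ?_⟩, fun t ht => ?_, fun t ht => ?_⟩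
  · have h := hΦd x hxc ⟨_, hxz⟩ t
    rwa [hx] at h
  · rw [norm_sub_rev, ← hzy t (by linarith)]
    exact hwμ hxz t
  · have h1 : ‖x t‖ ≤ ‖z t‖ + ‖x t - z t‖ := by simpa using norm_add_le (z t) (x t - z t)
    linarith [hwl hxz t, hzu t ht]

/-- Comparison of the deviations of two global solutions from entire solutions attracting
them. -/
theorem exp_mul_norm_deviation_sub_le (hF : WeaklyNonlinear τ F K A)
    (hK : 0 ≤ K) (hτ : 0 ≤ τ) {l μ q : ℝ} (hl : 0 < l) (hlμ : l ≤ μ) (hq₀ : 0 ≤ q) (hq : q < 1)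
    (hlq : K * Real.exp (l * τ) ≤ q * l) {t₀ : ℝ} {u v : Hist τ m}
    {y y' x x' : ℝ → Fin m → ℝ} (hy : IsGlobalSol τ F t₀ u y) (hy' : IsGlobalSol τ F t₀ v y')
    (hx : IsEntireSol τ F x) (hx' : IsEntireSol τ F x') {R R' c₀ : ℝ}
    (hR : ∀ t, t₀ ≤ t → ‖y t - x t‖ ≤ R * Real.exp (-μ * (t - t₀)))
    (hR' : ∀ t, t₀ ≤ t → ‖y' t - x' t‖ ≤ R' * Real.exp (-μ * (t - t₀)))
    (h₀ : ∀ t, ‖x t - x' t‖ ≤ c₀ * Real.exp (l * |t|)) {T t : ℝ} (hT : t₀ ≤ T) (ht : t₀ ≤ t) :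
    Real.exp (l * (t - t₀)) * ‖(y t - x t) - (y' t - x' t)‖
      ≤ (1 / (1 - q) + (1 / (1 - q)) ^ 2) * Real.exp (l * (T - t₀)) ^ 2 * ‖u - v‖
        + 1 / (1 - q) * (R + R') * Real.exp (-(μ - l) * (T - t₀)) := by
  set g := 1 / (1 - q) with hg
  have hg1 : 1 ≤ g := by
    rw [hg, le_div_iff₀ (by linarith)]
    linarith
  have hKq : K ≤ q * l :=
    (le_mul_of_one_le_right hK (Real.one_le_exp (by positivity))).trans hlq
  have hR0 : 0 ≤ R + R' := add_nonneg
    (nonneg_of_mul_nonneg_left ((norm_nonneg _).trans (hR t ht)) (Real.exp_pos _))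
    (nonneg_of_mul_nonneg_left ((norm_nonneg _).trans (hR' t ht)) (Real.exp_pos _))
  have hdev : ∀ s, t₀ ≤ s → ‖(y s - x s) - (y' s - x' s)‖
      ≤ (R + R') * Real.exp (-μ * (s - t₀)) := fun s hs => by
    have := _root_.norm_sub_le (y s - x s) (y' s - x' s)
    linarith [hR s hs, hR' s hs]
  have hsol : ∀ s, t₀ ≤ s → ‖y s - y' s‖ ≤ g * ‖u - v‖ * Real.exp (l * (s - t₀)) := by
    intro s hs
    have := hy.norm_sub_le hF hK hτ hl hq₀ hq hKq hy' hs
    rwa [div_eq_mul_one_div, ← hg, mul_comm ‖u - v‖] at this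
  have hmul : ∀ s, Real.exp (l * (s - t₀)) * Real.exp (-μ * (s - t₀))
      = Real.exp (-(μ - l) * (s - t₀)) := fun s => by
    rw [← Real.exp_add]
    ring_nf
  rcases le_total T t with h | h
  · have h1 : Real.exp (-(μ - l) * (t - t₀)) ≤ Real.exp (-(μ - l) * (T - t₀)) :=
      Real.exp_le_exp.2 (by nlinarith)
    have h2 := mul_le_mul_of_nonneg_left (hdev t ht) (Real.exp_pos (l * (t - t₀))).le
    have h3 : Real.exp (l * (t - t₀)) * ((R + R') * Real.exp (-μ * (t - t₀)))
        = (R + R') * Real.exp (-(μ - l) * (t - t₀)) := by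
      rw [← hmul t]
      ring
    have h4 := mul_le_mul_of_nonneg_left h1 hR0
    have h5 := le_mul_of_one_le_left (mul_nonneg hR0 (Real.exp_pos (-(μ - l) * (T - t₀))).le) hg1
    have h6 : 0 ≤ (g + g ^ 2) * Real.exp (l * (T - t₀)) ^ 2 * ‖u - v‖ := by positivity
    linarith
  · set G := Real.exp (l * (T - t₀)) with hG
    set D := ‖u - v‖ with hD
    have hD0 : 0 ≤ D := norm_nonneg _
    have hc₀ : 0 ≤ c₀ := nonneg_of_mul_nonneg_left ((norm_nonneg _).trans (h₀ 0)) (Real.exp_pos _)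
    have hET : ‖x T - x' T‖ ≤ g * D * G + (R + R') * Real.exp (-μ * (T - t₀)) := by
      have e : x T - x' T = (y T - y' T) - ((y T - x T) - (y' T - x' T)) := by abel
      rw [e]
      exact (_root_.norm_sub_le _ _).trans (add_le_add (hsol T hT) (hdev T hT))
    have hEt := hx.norm_sub_le hF hK hτ hl hq₀ hq hlq hx' (c₀ := c₀ * Real.exp (l * |T|)) T
      (fun s => by
        refine (h₀ s).trans ?_
        rw [mul_assoc, ← Real.exp_add, ← mul_add]
        refine mul_le_mul_of_nonneg_left (Real.exp_le_exp.2
          (mul_le_mul_of_nonneg_left ?_ hl.le)) hc₀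
        have := abs_add_le (s - T) T
        rw [sub_add_cancel] at this
        linarith) t
    rw [div_eq_mul_one_div, ← hg, abs_of_nonpos (sub_nonpos.2 h), neg_sub] at hEt
    have hexp : Real.exp (l * (t - t₀)) * Real.exp (l * (T - t)) = G := by
      rw [hG, ← Real.exp_add]
      ring_nf
    have htG : Real.exp (l * (t - t₀)) ≤ G :=
      Real.exp_le_exp.2 (mul_le_mul_of_nonneg_left (by linarith) hl.le)
    have e : (y t - x t) - (y' t - x' t) = (y t - y' t) - (x t - x' t) := by abel
    have h1 : ‖(y t - x t) - (y' t - x' t)‖ ≤ ‖y t - y' t‖ + ‖x t - x' t‖ := by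
      rw [e]
      exact _root_.norm_sub_le _ _
    calc Real.exp (l * (t - t₀)) * ‖(y t - x t) - (y' t - x' t)‖
        ≤ Real.exp (l * (t - t₀)) * (g * D * Real.exp (l * (t - t₀))
          + ‖x T - x' T‖ * g * Real.exp (l * (T - t))) :=
          mul_le_mul_of_nonneg_left (h1.trans (add_le_add (hsol t ht) hEt)) (Real.exp_pos _).le
      _ = g * D * (Real.exp (l * (t - t₀)) * Real.exp (l * (t - t₀)))
          + ‖x T - x' T‖ * g * G := by
          rw [← hexp]
          ring
      _ ≤ g * D * (G * G) + (g * D * G + (R + R') * Real.exp (-μ * (T - t₀))) * g * G := by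
          gcongr
      _ = (g + g ^ 2) * G ^ 2 * D
          + g * (R + R') * (G * Real.exp (-μ * (T - t₀))) := by ring
      _ = _ := by rw [hG, hmul T]

theorem IsSpecialSol.isEntireSol {x : ℝ → Fin m → ℝ} (hx : IsSpecialSol τ F x) :
    IsEntireSol τ F x := ⟨hx.1, hx.2.1⟩

theorem exp_growth_iff {x : ℝ → Fin m → ℝ} {C : ℝ} :
    (∀ t, Real.exp (-|t| / τ) * ‖x t‖ ≤ C) ↔ ∀ t, ‖x t‖ ≤ C * Real.exp (τ⁻¹ * |t|) := by
  refine forall_congr' fun t => ?_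
  rw [show -|t| / τ = -(τ⁻¹ * |t|) by ring, Real.exp_neg, inv_mul_le_iff₀ (Real.exp_pos _),
    mul_comm C]

theorem IsSpecialSol.exists_norm_sub_le {x y : ℝ → Fin m → ℝ} (hx : IsSpecialSol τ F x)
    (hy : IsSpecialSol τ F y) : ∃ c, 0 ≤ c ∧ ∀ t, ‖x t - y t‖ ≤ c * Real.exp (τ⁻¹ * |t|) := by
  obtain ⟨c, hc⟩ := hx.2.2
  obtain ⟨c', hc'⟩ := hy.2.2
  rw [exp_growth_iff] at hc hc'
  refine ⟨c + c', add_nonneg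
    (nonneg_of_mul_nonneg_left ((norm_nonneg _).trans (hc 0)) (Real.exp_pos _))
    (nonneg_of_mul_nonneg_left ((norm_nonneg _).trans (hc' 0)) (Real.exp_pos _)), fun t => ?_⟩
  rw [add_mul]
  exact (_root_.norm_sub_le _ _).trans (add_le_add (hc t) (hc' t))

theorem continuous_of_abs_sub_le_tail {V : Type*} [SeminormedAddCommGroup V] {f R : V → ℝ}
    {P h : ℝ → ℝ} {T₀ : ℝ} (hR : Continuous R)
    (hh : Filter.Tendsto h Filter.atTop (nhds 0))
    (hf : ∀ T, T₀ ≤ T → ∀ u v, |f u - f v| ≤ P T * ‖u - v‖ + (R u + R v) * h T) :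
    Continuous f := by
  refine continuous_iff_continuousAt.2 fun u => Metric.tendsto_nhds.2 fun ε hε => ?_
  have h1 : Filter.Tendsto (fun T => (R u + R u) * h T) Filter.atTop (nhds 0) := by
    simpa using hh.const_mul (R u + R u)
  obtain ⟨T, hTε, hT⟩ :=
    ((h1.eventually_lt_const hε).and (Filter.eventually_ge_atTop T₀)).exists
  have h2 : Filter.Tendsto (fun v => P T * ‖v - u‖ + (R v + R u) * h T) (nhds u)
      (nhds (P T * ‖u - u‖ + (R u + R u) * h T)) :=
    Continuous.tendsto (by fun_prop) u
  rw [sub_self, norm_zero, mul_zero, zero_add] at h2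
  filter_upwards [h2.eventually_lt_const hTε] with v hv
  rw [Real.dist_eq]
  exact (hf T hT v u).trans_lt hv

theorem exists_contraction_rates (hτ : 0 < τ) (hK : 0 < K) (hsmall : K * τ * Real.exp 1 < 1) :
    ∃ q μ : ℝ, 0 ≤ q ∧ q < 1 ∧ τ⁻¹ < μ ∧ K * Real.exp (τ⁻¹ * τ) ≤ q * τ⁻¹ ∧
      K * Real.exp (μ * τ) ≤ q * μ := by
  obtain ⟨q, hq, hq1⟩ := exists_between hsmall
  have hlt : K * Real.exp (τ⁻¹ * τ) < q * τ⁻¹ := by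
    rw [inv_mul_cancel₀ hτ.ne', ← div_eq_mul_inv, lt_div_iff₀ hτ]
    linarith
  have hev : ∀ᶠ μ in nhdsWithin τ⁻¹ (Ioi τ⁻¹), K * Real.exp (μ * τ) < q * μ :=
    nhdsWithin_le_nhds (ContinuousAt.eventually_lt (by fun_prop) (by fun_prop) hlt)
  obtain ⟨μ, hμ, hτμ⟩ := (hev.and self_mem_nhdsWithin).exists
  exact ⟨q, μ, ((by positivity : (0 : ℝ) ≤ K * τ * Real.exp 1).trans hq.le), hq1, hτμ,
    hlt.le, hμ.le⟩

theorem IsGlobalSol.exists_attracting_isSpecialSol (hF : WeaklyNonlinear τ F K A) (hA : 0 ≤ A)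
    (hK : 0 ≤ K) (hτ : 0 < τ) {μ q : ℝ} (hτμ : τ⁻¹ ≤ μ) (hq₀ : 0 ≤ q) (hq : q < 1)
    (hlq : K * Real.exp (τ⁻¹ * τ) ≤ q * τ⁻¹) (hμq : K * Real.exp (μ * τ) ≤ q * μ)
    {t₀ : ℝ} {u : Hist τ m} {y : ℝ → Fin m → ℝ} (hy : IsGlobalSol τ F t₀ u y) :
    ∃ x, IsSpecialSol τ F x ∧ ∀ t, t₀ ≤ t → ‖y t - x t‖
        ≤ (2 * ‖u‖ + (A + K * ‖u‖) / τ⁻¹) / (1 - q) * Real.exp (-μ * (t - t₀)) := by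
  have hl : 0 < τ⁻¹ := inv_pos.2 hτ
  have hKq : K ≤ q * τ⁻¹ :=
    (le_mul_of_one_le_right hK (Real.one_le_exp (by positivity))).trans hlq
  obtain ⟨x, hx, hxy, hxu⟩ :=
    hy.exists_attracting_entireSol hF hA hK hτ.le hl hτμ hq₀ hq hlq hμq
  set R := (2 * ‖u‖ + (A + K * ‖u‖) / τ⁻¹) / (1 - q) with hR
  set c := (‖u‖ + A / τ⁻¹) / (1 - q) with hc
  have hq' : 0 < 1 - q := by linarith
  have hR0 : 0 ≤ R := by positivity
  have hc0 : 0 ≤ c := by positivity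
  refine ⟨x, ⟨hx.1, hx.2, (‖u‖ + c + R) * Real.exp (τ⁻¹ * |t₀|), exp_growth_iff.2 fun t => ?_⟩,
    hxy⟩
  rw [mul_assoc, ← Real.exp_add, ← mul_add]
  have hexp : ∀ s, s ≤ |t₀| + |t| → Real.exp (τ⁻¹ * s) ≤ Real.exp (τ⁻¹ * (|t₀| + |t|)) :=
    fun s hs => Real.exp_le_exp.2 (mul_le_mul_of_nonneg_left hs hl.le)
  have hone : 1 ≤ Real.exp (τ⁻¹ * (|t₀| + |t|)) := Real.one_le_exp (by positivity)
  have hu := le_mul_of_one_le_right (norm_nonneg u) hone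
  rcases le_total t₀ t with ht | ht
  · have h1 : ‖x t‖ ≤ ‖y t‖ + ‖y t - x t‖ := by simpa using _root_.norm_sub_le (y t) (y t - x t)
    have h2 := hy.norm_le hF hA hK hτ.le hl hq₀ hq hKq (t := t) (by linarith)
    rw [max_eq_left (sub_nonneg.2 ht)] at h2
    have h3 := mul_le_mul_of_nonneg_left
      (hexp (t - t₀) (by linarith [le_abs_self t, neg_abs_le t₀])) hc0
    have h4 : Real.exp (-μ * (t - t₀)) ≤ Real.exp (τ⁻¹ * (|t₀| + |t|)) :=
      (Real.exp_le_one_iff.2 (by nlinarith)).trans hone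
    have h5 := mul_le_mul_of_nonneg_left h4 hR0
    have h6 := hxy t ht
    have h7 := norm_nonneg u
    linarith
  · have h3 := hxu t ht
    have h4 := mul_le_mul_of_nonneg_left
      (hexp (t₀ - t) (by linarith [le_abs_self t₀, neg_abs_le t])) hR0
    rw [show -τ⁻¹ * (t - t₀) = τ⁻¹ * (t₀ - t) by ring] at h3
    have h5 : 0 ≤ c * Real.exp (τ⁻¹ * (|t₀| + |t|)) := by positivity
    linarith

/-- The special solution attracting a given function at rate `1 / τ` is unique. -/
theorem IsSpecialSol.eq_of_attracting (hF : WeaklyNonlinear τ F K A) (hK : 0 ≤ K) (hτ : 0 < τ)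
    {q : ℝ} (hq : q < 1) (hlq : K * Real.exp (τ⁻¹ * τ) ≤ q * τ⁻¹) {t₀ c c' : ℝ}
    {y x x' : ℝ → Fin m → ℝ} (hx : IsSpecialSol τ F x) (hx' : IsSpecialSol τ F x')
    (h : ∀ t, t₀ ≤ t → Real.exp (t / τ) * ‖y t - x t‖ ≤ c)
    (h' : ∀ t, t₀ ≤ t → Real.exp (t / τ) * ‖y t - x' t‖ ≤ c') : x = x' := by
  obtain ⟨d, hd, hxx⟩ := hx.exists_norm_sub_le hx'
  have hcc : 0 ≤ c + c' := add_nonneg ((by positivity : (0 : ℝ) ≤ _).trans (h t₀ le_rfl))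
    ((by positivity : (0 : ℝ) ≤ _).trans (h' t₀ le_rfl))
  refine hx.isEntireSol.eq_of_decay hF hK hτ.le (inv_pos.2 hτ) hq hlq hx'.isEntireSol
    (c₀ := c + c' + d * Real.exp (τ⁻¹ * (2 * |t₀|))) (t₀ := 0) fun t => ?_
  rw [sub_zero, neg_mul, add_mul, mul_assoc d, ← Real.exp_add]
  rcases le_total t₀ t with ht | ht
  · have h1 : ‖x t - x' t‖ ≤ ‖y t - x' t‖ + ‖y t - x t‖ := by
      simpa using _root_.norm_sub_le (y t - x' t) (y t - x t)
    have h2 : ‖x t - x' t‖ ≤ (c + c') * Real.exp (-(τ⁻¹ * t)) := by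
      rw [Real.exp_neg, ← div_eq_mul_inv, le_div_iff₀ (Real.exp_pos _), inv_mul_eq_div, mul_comm]
      have h3 := mul_le_mul_of_nonneg_left h1 (Real.exp_pos (t / τ)).le
      linarith [h t ht, h' t ht]
    have h4 : 0 ≤ d * Real.exp (τ⁻¹ * (2 * |t₀|) + -(τ⁻¹ * t)) := by positivity
    linarith
  · have h1 : Real.exp (τ⁻¹ * |t|) ≤ Real.exp (τ⁻¹ * (2 * |t₀|) + -(τ⁻¹ * t)) := by
      rw [← mul_neg, ← mul_add]
      refine Real.exp_le_exp.2 (mul_le_mul_of_nonneg_left ?_ (inv_pos.2 hτ).le)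
      rcases abs_cases t with ⟨e, _⟩ | ⟨e, _⟩ <;> linarith [le_abs_self t₀, abs_nonneg t₀]
    have h2 := mul_le_mul_of_nonneg_left h1 hd
    have h3 : 0 ≤ (c + c') * Real.exp (-(τ⁻¹ * t)) := by positivity
    linarith [hxx t]

end Delay

/-- Exponential attraction towards special solutions: for every global
solution `y(t₀,u)`, (i) the limit `ȳ₀ = lim_{s→∞} ȳ(s, y(t₀,u)(s))(t₀)` exists, (ii) the
special solution `ȳ(t₀,ȳ₀)` attracts `y(t₀,u)` at exponential rate `1/τ` with bound
`C_u = sup_{t ≥ t₀} e^{t/τ} ‖y(t) - ȳ(t)‖ < ∞`, and (iii) for fixed `t₀` the bound `C_u`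
depends continuously on the initial data `u`. -/
theorem exponential_attraction_special_solutions
    {m : ℕ} (τ : ℝ) (hτ : 0 < τ) (F : ℝ → Hist τ m → Fin m → ℝ)
    (K A : ℝ) (hK : 0 < K) (hA : 0 ≤ A) (hF : WeaklyNonlinear τ F K A)
    (hsmall : K * τ * Real.exp 1 < 1) (t₀ : ℝ) :
    (∀ (u : Hist τ m) (y : ℝ → Fin m → ℝ), IsGlobalSol τ F t₀ u y →
      ∃ (ybar₀ : Fin m → ℝ) (ybar : ℝ → Fin m → ℝ),
        IsSpecialSol τ F ybar ∧ ybar t₀ = ybar₀ ∧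
        (∀ Y : ℝ → ℝ → Fin m → ℝ,
          (∀ s : ℝ, IsSpecialSol τ F (Y s) ∧ Y s s = y s) →
          Filter.Tendsto (fun s => Y s t₀) Filter.atTop (nhds ybar₀)) ∧
        ∃ C : ℝ, ∀ t : ℝ, t₀ ≤ t → Real.exp (t / τ) * ‖y t - ybar t‖ ≤ C) ∧
    ∃ Cfun : Hist τ m → ℝ, Continuous Cfun ∧
      ∀ (u : Hist τ m) (y ybar : ℝ → Fin m → ℝ),
        IsGlobalSol τ F t₀ u y → IsSpecialSol τ F ybar →
        (∃ C : ℝ, ∀ t : ℝ, t₀ ≤ t → Real.exp (t / τ) * ‖y t - ybar t‖ ≤ C) →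
        IsLUB {r : ℝ | ∃ t : ℝ, t₀ ≤ t ∧ r = Real.exp (t / τ) * ‖y t - ybar t‖} (Cfun u) := by
  obtain ⟨q, μ, hq₀, hq, hτμ, hlq, hμq⟩ := exists_contraction_rates hτ hK hsmall
  have hl : 0 < τ⁻¹ := inv_pos.2 hτ
  have hKq : K ≤ q * τ⁻¹ :=
    (le_mul_of_one_le_right hK.le (Real.one_le_exp (by positivity))).trans hlq
  have hq' : 0 < 1 - q := by linarith
  set R : Hist τ m → ℝ := fun u => (2 * ‖u‖ + (A + K * ‖u‖) / τ⁻¹) / (1 - q) with hR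
  have hR0 : ∀ u, 0 ≤ R u := fun u => by positivity
  have hexp : ∀ t, Real.exp (t / τ) = Real.exp (t₀ / τ) * Real.exp (τ⁻¹ * (t - t₀)) := fun t => by
    rw [← Real.exp_add]
    ring_nf
  have htail : Filter.Tendsto (fun T => Real.exp (-(μ - τ⁻¹) * (T - t₀))) Filter.atTop
      (nhds 0) :=
    Real.tendsto_exp_atBot.comp
      ((Filter.tendsto_atTop_add_const_right _ (-t₀) Filter.tendsto_id).const_mul_atTop_of_neg
        (by linarith))
  have hmul : ∀ t, Real.exp (τ⁻¹ * (t - t₀)) * Real.exp (-μ * (t - t₀))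
      = Real.exp (-(μ - τ⁻¹) * (t - t₀)) := fun t => by
    rw [← Real.exp_add]
    ring_nf
  have hattr : ∀ {u : Hist τ m} {y x : ℝ → Fin m → ℝ},
      (∀ t, t₀ ≤ t → ‖y t - x t‖ ≤ R u * Real.exp (-μ * (t - t₀))) →
      ∀ t, t₀ ≤ t → Real.exp (t / τ) * ‖y t - x t‖ ≤ Real.exp (t₀ / τ) * R u := by
    intro u y x h t ht
    rw [hexp, mul_assoc]
    refine mul_le_mul_of_nonneg_left ?_ (Real.exp_pos _).le
    refine (mul_le_mul_of_nonneg_left (h t ht) (Real.exp_pos _).le).trans ?_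
    rw [mul_left_comm, hmul]
    exact mul_le_of_le_one_right (hR0 u) (Real.exp_le_one_iff.2 (by nlinarith))
  refine ⟨fun u y hy => ?_, ?_⟩
  · obtain ⟨x, hx, hxy⟩ :=
      hy.exists_attracting_isSpecialSol hF hA hK.le hτ hτμ.le hq₀ hq hlq hμq
    refine ⟨x t₀, x, hx, rfl, fun Y hY => ?_, _, hattr hxy⟩
    rw [tendsto_iff_norm_sub_tendsto_zero]
    have hlim : Filter.Tendsto
        (fun s => R u / (1 - q) * Real.exp (-(μ - τ⁻¹) * (s - t₀))) Filter.atTop (nhds 0) := by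
      simpa using htail.const_mul (R u / (1 - q))
    refine squeeze_zero' (Filter.Eventually.of_forall fun s => norm_nonneg _) ?_ hlim
    filter_upwards [Filter.eventually_ge_atTop t₀] with s hs
    obtain ⟨c, hc, hYx⟩ := (hY s).1.exists_norm_sub_le hx
    have h := (hY s).1.isEntireSol.norm_sub_le hF hK.le hτ.le hl hq₀ hq hlq hx.isEntireSol
      (c₀ := c * Real.exp (τ⁻¹ * |s|)) s (fun t => by
        refine (hYx t).trans ?_
        rw [mul_assoc, ← Real.exp_add, ← mul_add]
        refine mul_le_mul_of_nonneg_left (Real.exp_le_exp.2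
          (mul_le_mul_of_nonneg_left ?_ hl.le)) hc
        have := abs_add_le (t - s) s
        rw [sub_add_cancel] at this
        linarith) t₀
    rw [(hY s).2, abs_of_nonpos (sub_nonpos.2 hs), neg_sub] at h
    refine h.trans ?_
    rw [← hmul s, div_mul_eq_mul_div, div_mul_eq_mul_div]
    refine div_le_div_of_nonneg_right ?_ hq'.le
    have h1 := mul_le_mul_of_nonneg_right (hxy s hs) (Real.exp_pos (τ⁻¹ * (s - t₀))).le
    linarith
  · choose y hy using exists_isGlobalSol hF hA hK.le hτ.le hl hq₀ hq hKq t₀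
    choose x hx hxy using fun u =>
      (hy u).exists_attracting_isSpecialSol hF hA hK.le hτ hτμ.le hq₀ hq hlq hμq
    have hlub : ∀ u, ∃ C, IsLUB
        {r : ℝ | ∃ t, t₀ ≤ t ∧ r = Real.exp (t / τ) * ‖y u t - x u t‖} C := fun u =>
      Real.exists_isLUB ⟨_, t₀, le_rfl, rfl⟩ ⟨_, by
        rintro _ ⟨t, ht, rfl⟩
        exact hattr (hxy u) t ht⟩
    choose C hC using hlub
    refine ⟨C, ?_, fun u y' x' hy' hx' hb => ?_⟩
    · have hle : ∀ T, t₀ ≤ T → ∀ u v, C u - C v ≤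
          Real.exp (t₀ / τ) * ((1 / (1 - q) + (1 / (1 - q)) ^ 2) *
            Real.exp (τ⁻¹ * (T - t₀)) ^ 2) * ‖u - v‖
          + (R u + R v) * (Real.exp (t₀ / τ) * (1 / (1 - q)) *
            Real.exp (-(μ - τ⁻¹) * (T - t₀))) := by
        intro T hT u v
        rw [sub_le_iff_le_add]
        refine (hC u).2 ?_
        rintro _ ⟨t, ht, rfl⟩
        obtain ⟨c, -, hxx⟩ := (hx u).exists_norm_sub_le (hx v)
        have h1 := exp_mul_norm_deviation_sub_le hF hK.le hτ.le hl hτμ.le hq₀ hq hlq (hy u) (hy v)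
          (hx u).isEntireSol (hx v).isEntireSol (hxy u) (hxy v) hxx hT ht
        have h2 := (hC v).1 ⟨t, ht, rfl⟩
        have h3 := mul_le_mul_of_nonneg_left (norm_sub_norm_le (y u t - x u t) (y v t - x v t))
          (Real.exp_pos (t / τ)).le
        have h4 := mul_le_mul_of_nonneg_left h1 (Real.exp_pos (t₀ / τ)).le
        rw [← mul_assoc, ← hexp] at h4
        linarith
      refine continuous_of_abs_sub_le_tail (T₀ := t₀) (R := R)
        (P := fun T => Real.exp (t₀ / τ) * ((1 / (1 - q) + (1 / (1 - q)) ^ 2) *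
            Real.exp (τ⁻¹ * (T - t₀)) ^ 2))
        (h := fun T => Real.exp (t₀ / τ) * (1 / (1 - q)) * Real.exp (-(μ - τ⁻¹) * (T - t₀)))
        (by fun_prop) (by simpa using htail.const_mul (Real.exp (t₀ / τ) * (1 / (1 - q))))
        fun T hT u v => abs_sub_le_iff.2 ⟨hle T hT u v, ?_⟩
      rw [norm_sub_rev u v, add_comm (R u)]
      exact hle T hT v u
    · have hyy : ∀ t, t₀ ≤ t → y' t = y u t := fun t ht => by
        have h := hy'.norm_sub_le hF hK.le hτ.le hl hq₀ hq hKq (hy u) ht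
        rw [sub_self, norm_zero, zero_div, zero_mul] at h
        exact sub_eq_zero.1 (norm_le_zero_iff.1 h)
      obtain ⟨c, hc⟩ := hb
      have hxx : x' = x u := hx'.eq_of_attracting hF hK.le hτ hq hlq (hx u)
        (fun t ht => by rw [← hyy t ht]; exact hc t ht) (hattr (hxy u))
      subst hxx
      convert hC u using 1
      ext r
      refine exists_congr fun t => and_congr_right fun ht => ?_
      rw [hyy t ht]
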